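/- Let r ≥ 2 be fixed and let a = (r!)^{1/(2r−1)} · n^{(r−1)/(2r−1)}; assume a is an integer dividing n, and partition [n] into q = n/a consecutive blocks A_i = {(i−1)a + 1, …, ia}. For a uniformly random permutation Π_n of [n], let B = B(Π_n) be the bipartite graph on vertex classes U = V = {1,…,q} with an edge ij whenever |{s ∈ A_i : Π_n(s) ∈ A_j}| ≥ r, and let ν(B) be its maximum matching size. Then for all sufficiently large n, E[ν(B)] ≥ n/(32a) = (1/32)·(r!)^{−1/(2r−1)}·n^{r/(2r−1)}. -/

import Mathlib

/-- The maximum size of a matching in the auxiliary bipartite graph `B(π)`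
associated with a permutation `π` of `[n]`, `n = a·q`: its vertex classes are two
copies of the `q` block indices (blocks of size `a`; position `s`, zero-based, lies
in block `s/a`), and `ij` is an edge iff at least `r` positions of block `i` are
mapped by `π` into block `j`. A matching of size `m` is given by injections
`f, g : Fin m → Fin q` with every `(f t, g t)` an edge. -/
noncomputable def matchingNumber (r a q : ℕ) (π : Equiv.Perm (Fin (a * q))) : ℕ :=
  sSup {m : ℕ | ∃ f g : Fin m → Fin q, Function.Injective f ∧ Function.Injective g ∧
    ∀ t, r ≤ (Finset.univ.filter fun s : Fin (a * q) =>
      (s : ℕ) / a = (f t : ℕ) ∧ ((π s : ℕ)) / a = (g t : ℕ)).card}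

section

open Finset

theorem card_perm_trans_eq_mul {ι α : Type*} [Fintype ι] [Fintype α] [DecidableEq ι] [DecidableEq α]
    (e e' : ι ↪ α) :
    #{π : Equiv.Perm α | e.trans π.toEmbedding = e'} *
      (Fintype.card α).descFactorial (Fintype.card ι) = (Fintype.card α).factorial := by
  have hconst : ∀ e'' : ι ↪ α, #{π : Equiv.Perm α | e.trans π.toEmbedding = e''} =
      #{π : Equiv.Perm α | e.trans π.toEmbedding = e'} := by
    intro e''
    obtain ⟨σ, hσ⟩ : ∃ σ : Equiv.Perm α, ∀ t, σ (e'' t) = e' t := by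
      let f : {x // x ∈ Set.range e''} ≃ {x // x ∈ Set.range e'} :=
        (Equiv.ofInjective e'' e''.injective).symm.trans (Equiv.ofInjective e' e'.injective)
      refine ⟨f.extendSubtype, fun t => ?_⟩
      rw [Equiv.extendSubtype_apply_of_mem _ _ ⟨t, rfl⟩]
      simp [f]
    refine Finset.card_bij' (fun π _ => σ * π) (fun π _ => σ⁻¹ * π) ?_ ?_ ?_ ?_
    · intro π hπ
      simp only [mem_filter, mem_univ, true_and] at hπ ⊢
      ext t
      simpa [← hπ] using hσ t
    · intro π hπ
      simp only [mem_filter, mem_univ, true_and] at hπ ⊢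
      ext t
      have := hσ t
      simp [← hπ] at this ⊢
      simp [← this]
    · simp
    · simp
  have h := Finset.card_eq_sum_card_fiberwise (s := (univ : Finset (Equiv.Perm α)))
    (f := fun π : Equiv.Perm α => e.trans π.toEmbedding) (t := univ) (by simp)
  rw [Finset.sum_congr rfl fun e'' _ => hconst e''] at h
  rw [Finset.sum_const, Finset.card_univ, Finset.card_univ, Fintype.card_perm,
    Fintype.card_embedding_eq] at h
  rw [h, smul_eq_mul, mul_comm]

theorem sum_card_trans_mem_mul {ι α : Type*} [Fintype ι] [Fintype α] [DecidableEq ι] [DecidableEq α]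
    (P Q : Finset (ι ↪ α)) :
    (∑ π : Equiv.Perm α, #{e ∈ P | e.trans π.toEmbedding ∈ Q}) *
      (Fintype.card α).descFactorial (Fintype.card ι) =
    #P * #Q * (Fintype.card α).factorial := by
  have h : ∀ π : Equiv.Perm α, #{e ∈ P | e.trans π.toEmbedding ∈ Q} =
      ∑ e ∈ P, ∑ e' ∈ Q, if e.trans π.toEmbedding = e' then 1 else 0 := by
    intro π
    rw [Finset.card_filter]
    simp
  rw [Finset.sum_congr rfl fun π _ => h π, Finset.sum_comm]
  simp_rw [Finset.sum_comm (s := (univ : Finset (Equiv.Perm α))), ← Finset.card_filter,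
    Finset.sum_mul, card_perm_trans_eq_mul]
  simp [mul_assoc]

/-- The embeddings of `ι` whose value at `t` lies in `S t`. -/
noncomputable def embeddingsInto {ι α : Type*} [Fintype ι] [Fintype α] [DecidableEq ι] [DecidableEq α]
    (S : ι → Finset α) : Finset (ι ↪ α) := {e | ∀ t, e t ∈ S t}

theorem mem_embeddingsInto {ι α : Type*} [Fintype ι] [Fintype α] [DecidableEq ι] [DecidableEq α]
    {S : ι → Finset α} {e : ι ↪ α} : e ∈ embeddingsInto S ↔ ∀ t, e t ∈ S t := by
  simp [embeddingsInto]

theorem card_embeddingsInto_const {ι α : Type*} [Fintype ι] [Fintype α] [DecidableEq ι]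
    [DecidableEq α] (S : Finset α) :
    #(embeddingsInto fun _ : ι => S) = (#S).descFactorial (Fintype.card ι) := by
  rw [← Fintype.card_coe S, ← Fintype.card_embedding_eq, ← Finset.card_univ]
  refine Finset.card_bij' (fun e he => ⟨fun t => ⟨e t, mem_embeddingsInto.1 he t⟩, fun x y h => ?_⟩)
    (fun e _ => e.trans (Function.Embedding.subtype _)) ?_ ?_ ?_ ?_
  · exact e.injective (congrArg Subtype.val h)
  · simp
  · intro e _
    exact mem_embeddingsInto.2 fun t => (e t).2
  · intro e _
    rfl
  · intro e _
    rfl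

theorem card_embeddingsInto_le {ι α : Type*} [Fintype ι] [Fintype α] [DecidableEq ι]
    [DecidableEq α] (S : ι → Finset α) : #(embeddingsInto S) ≤ ∏ t, #(S t) := by
  rw [← Fintype.card_piFinset]
  refine Finset.card_le_card_of_injOn (fun e t => e t) ?_ DFunLike.coe_injective.injOn
  intro e he
  exact Fintype.mem_piFinset.2 (mem_embeddingsInto.1 he)

theorem card_embeddingsInto_mul_le {ι κ α : Type*} [Fintype ι] [Fintype κ] [Fintype α]
    [DecidableEq ι] [DecidableEq κ] [DecidableEq α] {S T : Finset α} (h : Disjoint S T) :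
    #(embeddingsInto fun _ : ι => S) * #(embeddingsInto fun _ : κ => T) ≤
      #(embeddingsInto (Sum.elim (fun _ : ι => S) (fun _ : κ => T))) := by
  rw [← Finset.card_product]
  have hd : ∀ p ∈ (embeddingsInto fun _ : ι => S) ×ˢ (embeddingsInto fun _ : κ => T),
      ∀ x y, p.1 x ≠ p.2 y := by
    intro p hp x y hxy
    rw [mem_product, mem_embeddingsInto, mem_embeddingsInto] at hp
    exact Finset.disjoint_left.1 h (hp.1 x) (hxy ▸ hp.2 y)
  refine Finset.card_le_card_of_surjOn (fun e =>
    ((⟨Sum.inl, Sum.inl_injective⟩ : ι ↪ ι ⊕ κ).trans e,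
      (⟨Sum.inr, Sum.inr_injective⟩ : κ ↪ ι ⊕ κ).trans e)) ?_
  intro p hp
  refine ⟨⟨Sum.elim p.1 p.2, p.1.injective.sumElim p.2.injective (hd p hp)⟩, ?_, rfl⟩
  rw [mem_coe, mem_product, mem_embeddingsInto, mem_embeddingsInto] at hp
  refine mem_embeddingsInto.2 ?_
  rintro (t | t)
  · exact hp.1 t
  · exact hp.2 t

/-- The set of positions in block `i` of `[n]` (blocks have size `a`). -/
def block (a n i : ℕ) : Finset (Fin n) := {s | (s : ℕ) / a = i}

/-- The positions in block `i` that `π` sends into block `j`. -/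
def hits (a : ℕ) {n : ℕ} (π : Equiv.Perm (Fin n)) (i j : ℕ) : Finset (Fin n) :=
  {s | (s : ℕ) / a = i ∧ (π s : ℕ) / a = j}

theorem card_block {a q i : ℕ} (ha : 0 < a) (hi : i < q) : #(block a (a * q) i) = a := by
  have hlt : ∀ x < a, a * i + x < a * q := fun x hx => by nlinarith
  refine Finset.card_eq_of_equiv_fin ?_
  refine ⟨fun s => ⟨(s : Fin (a * q)) % a, Nat.mod_lt _ ha⟩,
    fun x => ⟨⟨a * i + x, hlt x x.2⟩, ?_⟩, ?_, ?_⟩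
  · simp [block, Nat.mul_add_div ha, Nat.div_eq_of_lt x.2]
  · rintro ⟨s, hs⟩
    simp only [block, mem_filter, mem_univ, true_and] at hs
    ext
    simp [← hs, Nat.div_add_mod]
  · intro x
    ext
    simp [Nat.mod_eq_of_lt x.2]

theorem sum_descFactorial_card_hits {a q i j : ℕ} (k : ℕ) (ha : 0 < a) (hi : i < q) (hj : j < q) :
    (∑ π : Equiv.Perm (Fin (a * q)), (#(hits a π i j)).descFactorial k) *
      (a * q).descFactorial k = a.descFactorial k ^ 2 * (a * q).factorial := by
  have h := sum_card_trans_mem_mul (embeddingsInto fun _ : Fin k => block a (a * q) i)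
    (embeddingsInto fun _ : Fin k => block a (a * q) j)
  simp only [card_embeddingsInto_const, card_block ha hi, card_block ha hj, Fintype.card_fin] at h
  rw [sq, ← h]
  congr 1
  refine Finset.sum_congr rfl fun π _ => ?_
  conv_lhs => rw [← Fintype.card_fin k, ← card_embeddingsInto_const]
  congr 1
  ext e
  simp [mem_embeddingsInto, hits, block, forall_and]

theorem sum_descFactorial_mul_descFactorial_le {a q i j i' j' : ℕ} (k : ℕ) (ha : 0 < a)
    (hi : i < q) (hj : j < q) (hi' : i' < q) (hj' : j' < q) (hne : i ≠ i' ∨ j ≠ j') :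
    (∑ π : Equiv.Perm (Fin (a * q)),
      (#(hits a π i j)).descFactorial k * (#(hits a π i' j')).descFactorial k) *
      (a * q).descFactorial (2 * k) ≤ a ^ (4 * k) * (a * q).factorial := by
  have h := sum_card_trans_mem_mul
    (embeddingsInto (Sum.elim (fun _ : Fin k => block a (a * q) i)
      (fun _ : Fin k => block a (a * q) i')))
    (embeddingsInto (Sum.elim (fun _ : Fin k => block a (a * q) j)
      (fun _ : Fin k => block a (a * q) j')))
  have hc : ∀ {i i'}, i < q → i' < q →
      #(embeddingsInto (Sum.elim (fun _ : Fin k => block a (a * q) i)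
        (fun _ : Fin k => block a (a * q) i'))) ≤ a ^ (2 * k) := by
    intro i i' hi hi'
    refine (card_embeddingsInto_le _).trans_eq ?_
    simp [card_block ha hi, card_block ha hi', ← pow_add, two_mul]
  simp only [Fintype.card_fin, Fintype.card_sum, ← two_mul] at h
  calc _ ≤ _ := Nat.mul_le_mul_right _ (Finset.sum_le_sum fun π _ => ?_)
    _ = _ := h
    _ ≤ a ^ (2 * k) * a ^ (2 * k) * (a * q).factorial :=
      Nat.mul_le_mul_right _ (Nat.mul_le_mul (hc hi hi') (hc hj hj'))
    _ = _ := by ring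
  have hd : Disjoint (hits a π i j) (hits a π i' j') := by
    rw [Finset.disjoint_left]
    intro s hs hs'
    simp only [hits, mem_filter, mem_univ, true_and] at hs hs'
    omega
  have h2 := card_embeddingsInto_mul_le (ι := Fin k) (κ := Fin k) hd
  simp only [card_embeddingsInto_const, Fintype.card_fin] at h2
  refine h2.trans (Finset.card_le_card fun e he => ?_)
  rw [mem_embeddingsInto] at he
  rw [mem_filter, mem_embeddingsInto, mem_embeddingsInto]
  refine ⟨?_, ?_⟩ <;> rintro (t | t)
  · simpa [block] using (mem_filter.1 (he (Sum.inl t))).2.1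
  · simpa [block] using (mem_filter.1 (he (Sum.inr t))).2.1
  · simpa [block] using (mem_filter.1 (he (Sum.inl t))).2.2
  · simpa [block] using (mem_filter.1 (he (Sum.inr t))).2.2

theorem card_le_matchingNumber {r a q : ℕ} (π : Equiv.Perm (Fin (a * q))) (M : Finset (ℕ × ℕ))
    (hM : ∀ p ∈ M, p.1 < q ∧ p.2 < q ∧ r ≤ #(hits a π p.1 p.2))
    (hfst : Set.InjOn Prod.fst (M : Set (ℕ × ℕ))) (hsnd : Set.InjOn Prod.snd (M : Set (ℕ × ℕ))) :
    #M ≤ matchingNumber r a q π := by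
  refine le_csSup ⟨q, ?_⟩ ?_
  · rintro m ⟨f, -, hf, -, -⟩
    simpa using Fintype.card_le_of_injective f hf
  · let e := M.equivFin.symm
    refine ⟨fun t => ⟨(e t).1.1, (hM _ (e t).2).1⟩, fun t => ⟨(e t).1.2, (hM _ (e t).2).2.1⟩,
      fun s t hst => ?_, fun s t hst => ?_, fun t => (hM _ (e t).2).2.2⟩
    · exact e.injective (Subtype.ext (hfst (e s).2 (e t).2 (congrArg Fin.val hst)))
    · exact e.injective (Subtype.ext (hsnd (e s).2 (e t).2 (congrArg Fin.val hst)))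

theorem card_edges_le {r a q m : ℕ} (hm : m ≤ q) (π : Equiv.Perm (Fin (a * q)))
    {x : ℕ → ℕ → ℕ} (hx : ∀ i j, x i j = if r ≤ #(hits a π i j) then 1 else 0) :
    ∑ p ∈ range m ×ˢ range m, x p.1 p.2 ≤ matchingNumber r a q π +
      ∑ p ∈ range m ×ˢ range m, (∑ j ∈ range p.2, x p.1 j * x p.1 p.2 +
        ∑ i ∈ range p.1, x i p.2 * x p.1 p.2) := by
  classical
  let M : Finset (ℕ × ℕ) := {p ∈ range m ×ˢ range m | r ≤ #(hits a π p.1 p.2) ∧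
    (∀ j < p.2, ¬ r ≤ #(hits a π p.1 j)) ∧ ∀ i < p.1, ¬ r ≤ #(hits a π i p.2)}
  have hM : ∀ p ∈ M, (p.1 < m ∧ p.2 < m) ∧ r ≤ #(hits a π p.1 p.2) ∧
      (∀ j < p.2, ¬ r ≤ #(hits a π p.1 j)) ∧ ∀ i < p.1, ¬ r ≤ #(hits a π i p.2) := by
    intro p hp
    simpa [M] using hp
  have hcard : #M ≤ matchingNumber r a q π := by
    refine card_le_matchingNumber π M
      (fun p hp => ⟨(hM p hp).1.1.trans_le hm, (hM p hp).1.2.trans_le hm, (hM p hp).2.1⟩) ?_ ?_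
    · rintro ⟨i, j⟩ hp ⟨i', j'⟩ hp' (rfl : i = i')
      obtain ⟨-, h1, h2, -⟩ := hM _ hp
      obtain ⟨-, h1', h2', -⟩ := hM _ hp'
      rcases lt_trichotomy j j' with h | rfl | h
      · exact absurd h1 (h2' _ h)
      · rfl
      · exact absurd h1' (h2 _ h)
    · rintro ⟨i, j⟩ hp ⟨i', j'⟩ hp' (rfl : j = j')
      obtain ⟨-, h1, -, h2⟩ := hM _ hp
      obtain ⟨-, h1', -, h2'⟩ := hM _ hp'
      rcases lt_trichotomy i i' with h | rfl | h
      · exact absurd h1 (h2' _ h)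
      · rfl
      · exact absurd h1' (h2 _ h)
  refine le_trans ?_ (Nat.add_le_add_right hcard _)
  rw [Finset.card_filter, ← Finset.sum_add_distrib]
  refine Finset.sum_le_sum fun p _ => ?_
  by_cases h0 : r ≤ #(hits a π p.1 p.2)
  swap
  · simp [hx, h0]
  by_cases h1 : ∀ j < p.2, ¬ r ≤ #(hits a π p.1 j)
  swap
  · push Not at h1
    obtain ⟨j, hj, hr⟩ := h1
    have := Finset.single_le_sum (f := fun j => x p.1 j * x p.1 p.2) (fun _ _ => Nat.zero_le _)
      (mem_range.2 hj)
    have h : x p.1 j * x p.1 p.2 = 1 := by simp [hx, h0, hr]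
    have h' : x p.1 p.2 = 1 := by simp [hx, h0]
    simp only [h] at this
    omega
  by_cases h2 : ∀ i < p.1, ¬ r ≤ #(hits a π i p.2)
  swap
  · push Not at h2
    obtain ⟨i, hi, hr⟩ := h2
    have := Finset.single_le_sum (f := fun i => x i p.2 * x p.1 p.2) (fun _ _ => Nat.zero_le _)
      (mem_range.2 hi)
    have h : x i p.2 * x p.1 p.2 = 1 := by simp [hx, h0, hr]
    have h' : x p.1 p.2 = 1 := by simp [hx, h0]
    simp only [h] at this
    omega
  rw [if_pos ⟨h0, h1, h2⟩, hx, if_pos h0]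
  omega

theorem descFactorial_le_succ_add (N r : ℕ) :
    N.descFactorial r ≤ N.descFactorial (r + 1) + r.factorial * if r ≤ N then 1 else 0 := by
  rcases lt_trichotomy N r with h | rfl | h
  · simp [Nat.descFactorial_eq_zero_iff_lt.2 h]
  · simp [Nat.descFactorial_self]
  · rw [Nat.descFactorial_succ]
    have : 1 * N.descFactorial r ≤ (N - r) * N.descFactorial r := Nat.mul_le_mul_right _ (by omega)
    omega

theorem factorial_mul_ite_le_descFactorial (N r : ℕ) :
    (r.factorial * if r ≤ N then 1 else 0) ≤ N.descFactorial r := by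
  split_ifs with h
  · rw [Nat.descFactorial_eq_factorial_mul_choose]
    exact Nat.mul_le_mul_left _ (Nat.choose_pos h)
  · simp

theorem factorial_mul_sum_descFactorial_le {r a q m : ℕ} (hm : m ≤ q)
    (π : Equiv.Perm (Fin (a * q))) {D : ℕ → ℕ → ℕ → ℕ}
    (hD : ∀ k i j, D k i j = (#(hits a π i j)).descFactorial k) :
    r.factorial * ∑ p ∈ range m ×ˢ range m, D r p.1 p.2 ≤
      r.factorial * ∑ p ∈ range m ×ˢ range m, D (r + 1) p.1 p.2 +
      r.factorial ^ 2 * matchingNumber r a q π +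
      ∑ p ∈ range m ×ˢ range m, (∑ j ∈ range p.2, D r p.1 j * D r p.1 p.2 +
        ∑ i ∈ range p.1, D r i p.2 * D r p.1 p.2) := by
  let x : ℕ → ℕ → ℕ := fun i j => if r ≤ #(hits a π i j) then 1 else 0
  have hxD : ∀ i j, r.factorial * x i j ≤ D r i j := fun i j => by
    rw [hD]
    exact factorial_mul_ite_le_descFactorial _ _
  have hxx : ∀ i j i' j', r.factorial ^ 2 * (x i j * x i' j') ≤ D r i j * D r i' j' := by
    intro i j i' j'
    calc _ = (r.factorial * x i j) * (r.factorial * x i' j') := by ring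
      _ ≤ _ := Nat.mul_le_mul (hxD _ _) (hxD _ _)
  have h1 : ∑ p ∈ range m ×ˢ range m, D r p.1 p.2 ≤
      ∑ p ∈ range m ×ˢ range m, D (r + 1) p.1 p.2 +
        r.factorial * ∑ p ∈ range m ×ˢ range m, x p.1 p.2 := by
    rw [Finset.mul_sum, ← Finset.sum_add_distrib]
    refine Finset.sum_le_sum fun p _ => ?_
    rw [hD, hD]
    exact descFactorial_le_succ_add _ _
  have h2 := card_edges_le hm π (x := x) fun _ _ => rfl
  have h3 : r.factorial ^ 2 * ∑ p ∈ range m ×ˢ range m, (∑ j ∈ range p.2, x p.1 j * x p.1 p.2 +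
        ∑ i ∈ range p.1, x i p.2 * x p.1 p.2) ≤
      ∑ p ∈ range m ×ˢ range m, (∑ j ∈ range p.2, D r p.1 j * D r p.1 p.2 +
        ∑ i ∈ range p.1, D r i p.2 * D r p.1 p.2) := by
    simp only [Finset.mul_sum, mul_add]
    exact Finset.sum_le_sum fun p _ => Nat.add_le_add
      (Finset.sum_le_sum fun j _ => hxx _ _ _ _) (Finset.sum_le_sum fun i _ => hxx _ _ _ _)
  have h4 := Nat.mul_le_mul_left r.factorial h1
  have h5 := Nat.mul_le_mul_left (r.factorial ^ 2) h2
  nlinarith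

theorem sum_range_product_add_le (m : ℕ) :
    ∑ p ∈ range m ×ˢ range m, (p.2 + p.1) ≤ m ^ 3 := by
  rw [Finset.sum_product]
  simp only [Finset.sum_add_distrib, Finset.sum_const, card_range, smul_eq_mul]
  rw [← Finset.mul_sum]
  have h := Finset.sum_range_id_mul_two m
  have h' : m * (m - 1) ≤ m * m := Nat.mul_le_mul_left _ (Nat.sub_le _ _)
  have : m * ((∑ i ∈ range m, i) * 2) ≤ m * (m * m) := Nat.mul_le_mul_left _ (h ▸ h')
  nlinarith

theorem factorial_mul_sq_mul_le {r a q m : ℕ} (ha : 0 < a) (hm : m ≤ q) (hn : 2 * r ≤ a * q)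
    (hn' : r + 1 ≤ a * q) :
    (r.factorial : ℝ) * m ^ 2 *
        ((a.descFactorial r : ℝ) ^ 2 / (a * q).descFactorial r) ≤
      (r.factorial : ℝ) * m ^ 2 *
        ((a.descFactorial (r + 1) : ℝ) ^ 2 / (a * q).descFactorial (r + 1)) +
      (r.factorial : ℝ) ^ 2 * ((∑ π : Equiv.Perm (Fin (a * q)), (matchingNumber r a q π : ℝ)) /
            ((a * q).factorial : ℝ)) +
      m ^ 3 * ((a : ℝ) ^ (4 * r) / (a * q).descFactorial (2 * r)) := by
  have hf : (0 : ℝ) < ((a * q).factorial : ℝ) := by exact_mod_cast Nat.factorial_pos _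
  have hmean : ∀ k ≤ a * q, ∀ p ∈ range m ×ˢ range m,
      (∑ π : Equiv.Perm (Fin (a * q)), ((#(hits a π p.1 p.2)).descFactorial k : ℝ)) =
        (a.descFactorial k : ℝ) ^ 2 / (a * q).descFactorial k * (a * q).factorial := by
    intro k hk p hp
    rw [mem_product, mem_range, mem_range] at hp
    have hpos : (0 : ℝ) < ((a * q).descFactorial k : ℝ) := by
      exact_mod_cast Nat.descFactorial_pos.2 hk
    rw [div_mul_eq_mul_div, eq_div_iff hpos.ne']
    exact_mod_cast sum_descFactorial_card_hits k ha (hp.1.trans_le hm) (hp.2.trans_le hm)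
  have hpair : ∀ i j i' j', i < q → j < q → i' < q → j' < q → (i ≠ i' ∨ j ≠ j') →
      (∑ π : Equiv.Perm (Fin (a * q)), ((#(hits a π i j)).descFactorial r : ℝ) *
        ((#(hits a π i' j')).descFactorial r : ℝ)) ≤
        (a : ℝ) ^ (4 * r) / (a * q).descFactorial (2 * r) * (a * q).factorial := by
    intro i j i' j' hi hj hi' hj' hne
    have hpos : (0 : ℝ) < ((a * q).descFactorial (2 * r) : ℝ) := by
      exact_mod_cast Nat.descFactorial_pos.2 hn
    rw [div_mul_eq_mul_div, le_div_iff₀ hpos]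
    exact_mod_cast sum_descFactorial_mul_descFactorial_le r ha hi hj hi' hj' hne
  set B := (a : ℝ) ^ (4 * r) / (a * q).descFactorial (2 * r) with hB
  have hB0 : 0 ≤ B := by positivity
  have hsum := Finset.sum_le_sum fun (π : Equiv.Perm (Fin (a * q))) (_ : π ∈ univ) =>
    (Nat.cast_le (α := ℝ)).2 (factorial_mul_sum_descFactorial_le (r := r) hm π
      (D := fun k i j => (#(hits a π i j)).descFactorial k) fun _ _ _ => rfl)
  push_cast at hsum
  simp only [Finset.sum_add_distrib, ← Finset.mul_sum] at hsum
  rw [Finset.sum_comm, Finset.sum_congr rfl (hmean r (by omega)),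
    Finset.sum_comm (s := univ) (t := range m ×ˢ range m)
      (f := fun π p => ((#(hits a π p.1 p.2)).descFactorial (r + 1) : ℝ)),
    Finset.sum_congr rfl (hmean (r + 1) (by omega))] at hsum
  have hT : (∑ π : Equiv.Perm (Fin (a * q)), ∑ p ∈ range m ×ˢ range m,
        ∑ j ∈ range p.2, ((#(hits a π p.1 j)).descFactorial r : ℝ) *
          ((#(hits a π p.1 p.2)).descFactorial r : ℝ)) +
      (∑ π : Equiv.Perm (Fin (a * q)), ∑ p ∈ range m ×ˢ range m,
        ∑ i ∈ range p.1, ((#(hits a π i p.2)).descFactorial r : ℝ) *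
          ((#(hits a π p.1 p.2)).descFactorial r : ℝ)) ≤ m ^ 3 * (B * (a * q).factorial) := by
    rw [Finset.sum_comm, Finset.sum_comm (s := univ) (t := range m ×ˢ range m),
      ← Finset.sum_add_distrib]
    calc _ ≤ ∑ p ∈ range m ×ˢ range m, ((p.2 + p.1 : ℕ) : ℝ) * (B * (a * q).factorial) := by
          refine Finset.sum_le_sum fun p hp => ?_
          rw [mem_product, mem_range, mem_range] at hp
          rw [Finset.sum_comm, Finset.sum_comm (s := univ) (t := range p.1), Nat.cast_add, add_mul]
          refine add_le_add ?_ ?_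
          · refine (Finset.sum_le_card_nsmul _ _ (B * (a * q).factorial) fun j hj => ?_).trans_eq
              (by simp)
            rw [mem_range] at hj
            exact hpair _ _ _ _ (by omega) (by omega) (by omega) (by omega) (.inr hj.ne)
          · refine (Finset.sum_le_card_nsmul _ _ (B * (a * q).factorial) fun i hi => ?_).trans_eq
              (by simp)
            rw [mem_range] at hi
            exact hpair _ _ _ _ (by omega) (by omega) (by omega) (by omega) (.inl hi.ne)
      _ = ((∑ p ∈ range m ×ˢ range m, (p.2 + p.1) : ℕ) : ℝ) * (B * (a * q).factorial) := by
          rw [← Finset.sum_mul, Nat.cast_sum]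
      _ ≤ _ := by
          refine mul_le_mul_of_nonneg_right ?_ (by positivity)
          exact_mod_cast sum_range_product_add_le m
  simp only [Finset.sum_const, card_product, card_range, nsmul_eq_mul, Nat.cast_mul] at hsum
  refine le_of_mul_le_mul_right ?_ hf
  have hν : (∑ π : Equiv.Perm (Fin (a * q)), (matchingNumber r a q π : ℝ)) /
      ((a * q).factorial : ℝ) * (a * q).factorial =
      ∑ π : Equiv.Perm (Fin (a * q)), (matchingNumber r a q π : ℝ) := div_mul_cancel₀ _ hf.ne'
  simp only [add_mul]
  rw [mul_assoc ((r.factorial : ℝ) ^ 2), hν]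
  linarith

theorem pow_mul_one_sub_le_descFactorial {x k : ℕ} (hx : 0 < x) (hk : k ≤ x) :
    (x : ℝ) ^ k * (1 - (k : ℝ) ^ 2 / x) ≤ x.descFactorial k := by
  have hx' : (0 : ℝ) < x := by exact_mod_cast hx
  have hkx : (k : ℝ) / x ≤ 1 := (div_le_one hx').2 (by exact_mod_cast hk)
  calc (x : ℝ) ^ k * (1 - (k : ℝ) ^ 2 / x) = (x : ℝ) ^ k * (1 + k * (-(k / x))) := by ring
    _ ≤ (x : ℝ) ^ k * (1 + -(k / x)) ^ k :=
        mul_le_mul_of_nonneg_left (one_add_mul_le_pow (by linarith) k) (by positivity)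
    _ = ((x - k : ℕ) : ℝ) ^ k := by
        rw [← mul_pow, Nat.cast_sub hk]
        congr 1
        field_simp
        ring
    _ ≤ x.descFactorial k := by
        exact_mod_cast (Nat.pow_le_pow_left (by omega) k).trans (Nat.pow_sub_le_descFactorial x k)

theorem pow_eq_factorial_mul_pow {r a q : ℕ} (hr : 1 ≤ r) (hn : 0 < a * q)
    (h : (a : ℝ) = (r.factorial : ℝ) ^ (1 / (2 * (r : ℝ) - 1)) *
      ((a * q : ℕ) : ℝ) ^ (((r : ℝ) - 1) / (2 * (r : ℝ) - 1))) :
    a ^ r = r.factorial * q ^ (r - 1) := by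
  obtain ⟨s, rfl⟩ := Nat.exists_eq_add_of_le' hr
  have ha : 0 < a := Nat.pos_of_mul_pos_right hn
  have hs : (2 * ((s + 1 : ℕ) : ℝ) - 1) = ((2 * s + 1 : ℕ) : ℝ) := by push_cast; ring
  have hs' : ((s + 1 : ℕ) : ℝ) - 1 = (s : ℝ) := by push_cast; ring
  rw [hs, hs'] at h
  have h0 : ((2 * s + 1 : ℕ) : ℝ) ≠ 0 := by positivity
  have hpow : (a : ℝ) ^ (2 * s + 1) = (s + 1).factorial * ((a * q : ℕ) : ℝ) ^ s := by
    rw [h, mul_pow, ← Real.rpow_mul_natCast (by positivity),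
      ← Real.rpow_mul_natCast (by positivity), div_mul_cancel₀ _ h0, div_mul_cancel₀ _ h0,
      Real.rpow_one, Real.rpow_natCast]
  have hnat : a ^ (2 * s + 1) = (s + 1).factorial * (a * q) ^ s := by exact_mod_cast hpow
  refine Nat.eq_of_mul_eq_mul_left (pow_pos ha s) ?_
  rw [Nat.add_sub_cancel]
  calc a ^ s * a ^ (s + 1) = a ^ (2 * s + 1) := by ring
    _ = _ := by rw [hnat]; ring

theorem exists_forall_le_of_pow_eq {r : ℕ} (hr : 2 ≤ r) (K L : ℕ) :
    ∃ n₀ : ℕ, ∀ a q : ℕ, n₀ ≤ a * q → a ^ r = r.factorial * q ^ (r - 1) → K ≤ a ∧ L ≤ q := by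
  refine ⟨K ^ (r + 1) + r.factorial * L ^ 2 + 1, fun a q hn h => ?_⟩
  have hq0 : 0 < q := Nat.pos_of_ne_zero (by rintro rfl; omega)
  have hF : 0 < r.factorial := Nat.factorial_pos r
  constructor
  · by_contra! hlt
    have hqa : q ≤ a ^ r := by
      calc q = 1 * q ^ 1 := by ring
        _ ≤ r.factorial * q ^ (r - 1) :=
          Nat.mul_le_mul hF (Nat.pow_le_pow_right hq0 (by omega))
        _ = a ^ r := h.symm
    have : a * q ≤ K ^ (r + 1) := by
      calc a * q ≤ a * a ^ r := Nat.mul_le_mul_left _ hqa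
        _ = a ^ (r + 1) := by ring
        _ ≤ _ := Nat.pow_le_pow_left hlt.le _
    omega
  · by_contra! hlt
    have haq : a ≤ r.factorial * q := by
      refine (Nat.pow_le_pow_iff_left (n := r) (by omega)).1 ?_
      rw [h, mul_pow]
      exact Nat.mul_le_mul (Nat.le_self_pow (by omega) _) (Nat.pow_le_pow_right hq0 (by omega))
    have : a * q ≤ r.factorial * L ^ 2 := by
      calc a * q ≤ r.factorial * q * q := Nat.mul_le_mul_right _ haq
        _ = r.factorial * q ^ 2 := by ring
        _ ≤ _ := Nat.mul_le_mul_left _ (Nat.pow_le_pow_left hlt.le _)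
    omega

theorem eight_mul_le_of_pow_eq {r a q : ℕ} (hr : 1 ≤ r) (h : a ^ r = r.factorial * q ^ (r - 1))
    (hq : 8 ^ r * r.factorial ≤ q) : 8 * a ≤ q := by
  refine (Nat.pow_le_pow_iff_left (n := r) (by omega)).1 ?_
  calc (8 * a) ^ r = 8 ^ r * r.factorial * q ^ (r - 1) := by rw [mul_pow, h]; ring
    _ ≤ q * q ^ (r - 1) := Nat.mul_le_mul_right _ hq
    _ = q ^ r := by rw [← pow_succ', Nat.sub_add_cancel hr]

theorem div_pow_eq_of_pow_eq {r a q : ℕ} (hr : 1 ≤ r) (hq : 0 < q)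
    (h : a ^ r = r.factorial * q ^ (r - 1)) :
    (a : ℝ) ^ r / (q : ℝ) ^ r = r.factorial / q := by
  have hq' : (q : ℝ) ≠ 0 := by positivity
  have h' : (a : ℝ) ^ r = r.factorial * (q : ℝ) ^ (r - 1) := by exact_mod_cast h
  rw [h', div_eq_div_iff (by positivity) hq', mul_assoc, ← pow_succ, Nat.sub_add_cancel hr]

theorem descFactorial_sq_div_sub_ge {r a q : ℕ} (hr : 1 ≤ r) (ha : 40 * r ^ 2 ≤ a)
    (hq : 8 * a ≤ q) (h : a ^ r = r.factorial * q ^ (r - 1)) :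
    3 / 4 * ((r.factorial : ℝ) / q) ≤
      (a.descFactorial r : ℝ) ^ 2 / (a * q).descFactorial r -
        (a.descFactorial (r + 1) : ℝ) ^ 2 / (a * q).descFactorial (r + 1) := by
  have hra : r < a := by nlinarith
  have ha0 : 0 < a := by omega
  have hq0 : 0 < q := by omega
  have hn : a ≤ a * q := Nat.le_mul_of_pos_right a hq0
  have har : (0 : ℝ) < a := by exact_mod_cast ha0
  have hqr : (0 : ℝ) < q := by exact_mod_cast hq0
  have hrar : (r : ℝ) < a := by exact_mod_cast hra
  have hnr : (a : ℝ) ≤ a * q := by exact_mod_cast hn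
  have hpos : (0 : ℝ) < ((a * q).descFactorial r : ℝ) := by
    exact_mod_cast Nat.descFactorial_pos.2 (by omega)
  set C := (a.descFactorial r : ℝ) ^ 2 / (a * q).descFactorial r with hC
  have hsucc : (a.descFactorial (r + 1) : ℝ) ^ 2 / (a * q).descFactorial (r + 1) =
      C * (((a : ℝ) - r) ^ 2 / (a * q - r)) := by
    rw [Nat.descFactorial_succ, Nat.descFactorial_succ, Nat.cast_mul, Nat.cast_mul,
      Nat.cast_sub hra.le, Nat.cast_sub (by omega), Nat.cast_mul, hC, div_mul_div_comm]
    congr 1 <;> ring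
  have hratio : ((a : ℝ) - r) ^ 2 / (a * q - r) ≤ 1 / 8 := by
    have hq8 : (8 * a : ℝ) ≤ q := by exact_mod_cast hq
    rw [div_le_iff₀ (by linarith)]
    have h1 : (1 : ℝ) ≤ a := by exact_mod_cast ha0
    have h2 : (0 : ℝ) ≤ r := by positivity
    nlinarith [mul_le_mul_of_nonneg_left hq8 har.le]
  have hdesc : 39 / 40 * (a : ℝ) ^ r ≤ a.descFactorial r := by
    refine le_trans ?_ (pow_mul_one_sub_le_descFactorial ha0 hra.le)
    rw [mul_comm]
    refine mul_le_mul_of_nonneg_left ?_ (by positivity)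
    have : (r : ℝ) ^ 2 / a ≤ 1 / 40 := by
      rw [div_le_iff₀ har]
      have : (40 * r ^ 2 : ℝ) ≤ a := by exact_mod_cast ha
      linarith
    linarith
  have hCge : (39 / 40) ^ 2 * ((r.factorial : ℝ) / q) ≤ C := by
    rw [← div_pow_eq_of_pow_eq hr hq0 h]
    have hle : ((a * q).descFactorial r : ℝ) ≤ (a : ℝ) ^ r * (q : ℝ) ^ r := by
      rw [← mul_pow]
      exact_mod_cast Nat.descFactorial_le_pow (a * q) r
    calc (39 / 40) ^ 2 * ((a : ℝ) ^ r / (q : ℝ) ^ r) =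
        (39 / 40 * (a : ℝ) ^ r) ^ 2 / ((a : ℝ) ^ r * (q : ℝ) ^ r) := by field_simp
      _ ≤ C := by rw [hC]; gcongr
  have hF : 0 ≤ (r.factorial : ℝ) / q := by positivity
  have hC0 : 0 ≤ C := by positivity
  rw [hsucc]
  nlinarith [mul_le_mul_of_nonneg_left hratio hC0]

theorem pow_div_descFactorial_le {r a q : ℕ} (hr : 1 ≤ r) (ha : 40 * r ^ 2 ≤ a) (hq : 0 < q)
    (h : a ^ r = r.factorial * q ^ (r - 1)) :
    (a : ℝ) ^ (4 * r) / (a * q).descFactorial (2 * r) ≤ 9 / 8 * ((r.factorial : ℝ) / q) ^ 2 := by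
  have hra : 2 * r ≤ a := by nlinarith
  have ha0 : 0 < a := by omega
  have hn : a ≤ a * q := Nat.le_mul_of_pos_right a hq
  have hdesc : 9 / 10 * ((a : ℝ) * q) ^ (2 * r) ≤ (a * q).descFactorial (2 * r) := by
    refine le_trans ?_ (pow_mul_one_sub_le_descFactorial (by omega) (by omega))
    rw [mul_comm, Nat.cast_mul]
    refine mul_le_mul_of_nonneg_left ?_ (by positivity)
    have : ((2 * r : ℕ) : ℝ) ^ 2 / ((a : ℝ) * q) ≤ 1 / 10 := by
      rw [div_le_iff₀ (by positivity)]
      have : (40 * r ^ 2 : ℝ) ≤ a * q := by exact_mod_cast ha.trans hn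
      push_cast
      linarith
    linarith
  have haR : (0 : ℝ) < a := by exact_mod_cast ha0
  have hqR : (0 : ℝ) < q := by exact_mod_cast hq
  calc (a : ℝ) ^ (4 * r) / (a * q).descFactorial (2 * r) ≤
      (a : ℝ) ^ (4 * r) / (9 / 10 * ((a : ℝ) * q) ^ (2 * r)) := by gcongr
    _ = 10 / 9 * ((a : ℝ) ^ r / (q : ℝ) ^ r) ^ 2 := by
        field_simp
        ring
    _ ≤ 9 / 8 * ((a : ℝ) ^ r / (q : ℝ) ^ r) ^ 2 := by
        exact mul_le_mul_of_nonneg_right (by norm_num) (by positivity)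
    _ = _ := by rw [div_pow_eq_of_pow_eq hr hq h]

theorem div_le_mean_matchingNumber {r a q : ℕ} (hr : 1 ≤ r) (ha : 40 * r ^ 2 ≤ a)
    (hq6 : 6 ≤ q) (hq : 8 * a ≤ q) (h : a ^ r = r.factorial * q ^ (r - 1)) :
    (q : ℝ) / 32 ≤ (∑ π : Equiv.Perm (Fin (a * q)), (matchingNumber r a q π : ℝ)) /
      ((a * q).factorial : ℝ) := by
  have hra : 2 * r ≤ a := by nlinarith
  have hn : a ≤ a * q := Nat.le_mul_of_pos_right a (by omega)
  have hqR : (0 : ℝ) < q := by exact_mod_cast (show 0 < q by omega)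
  have hF : (0 : ℝ) < r.factorial := by exact_mod_cast Nat.factorial_pos r
  have hmain := factorial_mul_sq_mul_le (r := r) (a := a) (q := q) (m := q / 2) (by omega)
    (by omega) (by omega) (by omega)
  have hA := descFactorial_sq_div_sub_ge hr ha hq h
  have hB := pow_div_descFactorial_le hr ha (by omega) h
  have hm2 : 2 * ((q / 2 : ℕ) : ℝ) ≤ q := by exact_mod_cast (show 2 * (q / 2) ≤ q by omega)
  have hm1 : (q : ℝ) ≤ 2 * ((q / 2 : ℕ) : ℝ) + 1 := by
    exact_mod_cast (show q ≤ 2 * (q / 2) + 1 by omega)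
  set m : ℝ := ((q / 2 : ℕ) : ℝ) with hm
  have hq6' : (6 : ℝ) ≤ q := by exact_mod_cast hq6
  have hm0 : 0 ≤ m := by positivity
  set ν := (∑ π : Equiv.Perm (Fin (a * q)), (matchingNumber r a q π : ℝ)) /
      ((a * q).factorial : ℝ) with hν
  have h1 := mul_le_mul_of_nonneg_left hA (show 0 ≤ (r.factorial : ℝ) * m ^ 2 by positivity)
  have h2 := mul_le_mul_of_nonneg_left hB (show 0 ≤ m ^ 3 by positivity)
  have h3 : (r.factorial : ℝ) ^ 2 * (3 / 4 * (m ^ 2 / q)) ≤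
      (r.factorial : ℝ) ^ 2 * (ν + 9 / 8 * (m ^ 3 / q ^ 2)) := by
    have e1 : (r.factorial : ℝ) ^ 2 * (3 / 4 * (m ^ 2 / q)) =
        r.factorial * m ^ 2 * (3 / 4 * (r.factorial / q)) := by ring
    have e2 : (r.factorial : ℝ) ^ 2 * (ν + 9 / 8 * (m ^ 3 / q ^ 2)) =
        (r.factorial : ℝ) ^ 2 * ν + m ^ 3 * (9 / 8 * (r.factorial / q) ^ 2) := by ring
    rw [e1, e2]
    linarith
  have h4 := le_of_mul_le_mul_left h3 (by positivity)
  have h5 : m ^ 3 / (q : ℝ) ^ 2 ≤ 1 / 2 * (m ^ 2 / q) := by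
    rw [div_le_iff₀ (by positivity)]
    have : 1 / 2 * (m ^ 2 / q) * (q : ℝ) ^ 2 = 1 / 2 * m ^ 2 * q := by field_simp
    rw [this]
    nlinarith [mul_le_mul_of_nonneg_left hm2 (sq_nonneg m)]
  have h6 : (q : ℝ) / 6 ≤ m ^ 2 / q := by
    rw [le_div_iff₀ hqR]
    nlinarith
  linarith

end

/-- Let `r ≥ 2` and `a = (r!)^(1/(2r-1)) · n^((r-1)/(2r-1))`, assumed to be an
integer dividing `n` (we write `n = a·q`). Then, for all sufficiently large `n`, the
expected matching number of the auxiliary bipartite graph of a uniformly random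
permutation of `[n]` is at least `n/(32a)`. -/
theorem expected_matchingNumber_lower (r : ℕ) (hr : 2 ≤ r) :
    ∃ n₀ : ℕ, ∀ a q : ℕ, n₀ ≤ a * q →
      (a : ℝ) = (r.factorial : ℝ) ^ (1 / (2 * (r : ℝ) - 1)) *
          ((a * q : ℕ) : ℝ) ^ (((r : ℝ) - 1) / (2 * (r : ℝ) - 1)) →
      ((a * q : ℕ) : ℝ) / (32 * (a : ℝ))
        ≤ (∑ π : Equiv.Perm (Fin (a * q)), (matchingNumber r a q π : ℝ)) /
            ((a * q).factorial : ℝ) := by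
  obtain ⟨n₀, hn₀⟩ := exists_forall_le_of_pow_eq hr (40 * r ^ 2) (8 ^ r * r.factorial + 6)
  refine ⟨n₀ + 1, fun a q hn h => ?_⟩
  have hpow := pow_eq_factorial_mul_pow (by omega) (by omega) h
  obtain ⟨ha, hq⟩ := hn₀ a q (by omega) hpow
  have ha0 : (a : ℝ) ≠ 0 := by
    have : 0 < a := Nat.pos_of_mul_pos_right (a := a) (b := q) (by omega)
    positivity
  have h8 := eight_mul_le_of_pow_eq (by omega) hpow (by omega)
  refine le_of_eq_of_le ?_ (div_le_mean_matchingNumber (by omega) ha (by omega) h8 hpow)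
  rw [Nat.cast_mul]
  field_simp
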